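/- arXiv:1401.4296 — 5 statements merged into one kernel-verified Lean document; each statement's English description precedes it below -/
import Mathlib

section
/- Let χ be a primitive even Dirichlet character modulo M and ψ a primitive Dirichlet character modulo N. Let m be a negative integer that is a critical point of L(ψ,s), i.e. ψ(−1) = (−1)^{m+1}. Let χψ denote the Dirichlet character modulo lcm(M,N) obtained as the product of the extensions of χ and ψ to modulus lcm(M,N). Then there exists k ∈ ℚ(χ,ψ) such that L(χψ, 1−m) = k · τ(χ) · L(ψ, 1−m). -/
open Complex DirichletCharacter

instance lcmNeZero {M N : ℕ} [NeZero M] [NeZero N] : NeZero (Nat.lcm M N) :=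
  ⟨Nat.lcm_ne_zero (NeZero.ne M) (NeZero.ne N)⟩

/-- The Gauss sum `τ(χ) = ∑_{x mod N} χ(x) e^{2πi x/N}` of a Dirichlet character mod `N`. -/
noncomputable def gaussSumStd {N : ℕ} [NeZero N] (χ : DirichletCharacter ℂ N) : ℂ :=
  gaussSum χ ZMod.stdAddChar

/-- `x ↦ exp(2πi x t)` for rational `t`. -/
noncomputable def ratExp (t : ℚ) (x : ℤ) : ℂ := cexp (2 * Real.pi * I * x * t)

lemma ratExp_add (s t : ℚ) (x : ℤ) : ratExp (s + t) x = ratExp s x * ratExp t x := by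
  unfold ratExp
  rw [← Complex.exp_add]
  congr 1
  push_cast
  ring

lemma ratExp_fract (t : ℚ) (x : ℤ) : ratExp (Int.fract t) x = ratExp t x := by
  have h : t = Int.fract t + (⌊t⌋ : ℚ) := (Int.fract_add_floor t).symm
  conv_rhs => rw [h, ratExp_add]
  have : ratExp (⌊t⌋ : ℚ) x = 1 := by
    unfold ratExp
    rw [Complex.exp_eq_one_iff]
    refine ⟨x * ⌊t⌋, ?_⟩
    push_cast
    ring
  rw [this, mul_one]

lemma hasSum_ratExp {n : ℕ} (hn : 2 ≤ n) (t : ℚ) : ∃ q : ℚ,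
    HasSum (fun x : ℕ => (1 : ℂ) / (x : ℂ) ^ n * (ratExp t x + (-1 : ℂ) ^ n * ratExp t (-x)))
      ((2 * Real.pi * I) ^ n * q) := by
  have hx : ((Int.fract t : ℚ) : ℝ) ∈ Set.Icc (0 : ℝ) 1 := by
    constructor
    · exact_mod_cast Int.fract_nonneg t
    · exact_mod_cast (Int.fract_lt_one t).le
  refine ⟨-((Polynomial.bernoulli n).eval (Int.fract t)) / n.factorial, ?_⟩
  have key := hasSum_one_div_nat_pow_mul_fourier hn hx
  have hb : bernoulliFun n ((Int.fract t : ℚ) : ℝ)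
      = (((Polynomial.bernoulli n).eval (Int.fract t) : ℚ) : ℝ) := by
    unfold bernoulliFun
    rw [Polynomial.eval_map]
    exact Polynomial.eval₂_at_apply (algebraMap ℚ ℝ) (Int.fract t)
  rw [hb] at key
  convert key using 1
  · funext x
    rw [fourier_coe_apply, fourier_coe_apply, ← ratExp_fract t, ← ratExp_fract t]
    unfold ratExp
    simp only [Complex.ofReal_one, div_one, Complex.ofReal_ratCast, Int.cast_neg]
  · push_cast
    ring

lemma lseries_rational {n : ℕ} (hn : 2 ≤ n) (K : Subfield ℂ) {ι : Type*} [Fintype ι]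
    (c : ι → ℂ) (hc : ∀ i, c i ∈ K) (t : ι → ℚ) (T : ℂ) (Φ : ℤ → ℂ)
    (hΦ : ∀ x, Φ x = T * ∑ i, c i * ratExp (t i) x)
    (hpar : ∀ x, Φ (-x) = (-1) ^ n * Φ x) :
    ∃ k ∈ K, LSeries (fun x : ℕ => Φ x) n = T * (2 * Real.pi * I) ^ n * k := by
  choose q hq using fun i => hasSum_ratExp hn (t i)
  refine ⟨(∑ i, c i * q i) / 2, ?_, ?_⟩
  · refine div_mem (sum_mem fun i _ => mul_mem (hc i) (SubfieldClass.ratCast_mem K (q i))) ?_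
    exact_mod_cast natCast_mem K 2
  · have h1 : HasSum (fun x : ℕ => T * ∑ i, c i * ((1 : ℂ) / (x : ℂ) ^ n *
        (ratExp (t i) x + (-1 : ℂ) ^ n * ratExp (t i) (-x))))
        (T * ∑ i, c i * ((2 * Real.pi * I) ^ n * q i)) :=
      (hasSum_sum fun i _ => (hq i).mul_left (c i)).mul_left T
    have h2 := h1.div_const 2
    have h3 : LSeriesHasSum (fun x : ℕ => Φ x) n
        ((T * ∑ i, c i * ((2 * Real.pi * I) ^ n * q i)) / 2) := by
      unfold LSeriesHasSum
      refine Eq.mpr (congrArg (fun f => HasSum f _) (funext fun x => ?_)) h2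
      have hs : ((-1 : ℂ) ^ n) * (-1) ^ n = 1 := by rw [← mul_pow]; simp
      have e1 : T * ∑ i, c i * ((1 : ℂ) / (x : ℂ) ^ n *
          (ratExp (t i) x + (-1 : ℂ) ^ n * ratExp (t i) (-x)))
          = 1 / (x : ℂ) ^ n * (Φ x + (-1) ^ n * Φ (-x)) := by
        rw [hΦ, hΦ]
        simp only [Finset.mul_sum]
        rw [← Finset.sum_add_distrib, Finset.mul_sum]
        refine Finset.sum_congr rfl fun i _ => ?_
        ring
      rw [e1, hpar, ← mul_assoc ((-1 : ℂ) ^ n), hs,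
        LSeries.term_of_ne_zero' (by exact_mod_cast (by lia : n ≠ 0)), Complex.cpow_natCast]
      ring
    rw [h3.LSeries_eq]
    simp only [mul_left_comm _ ((2 * Real.pi * I : ℂ) ^ n), ← Finset.mul_sum]
    ring

lemma stdAddChar_ratExp {M : ℕ} [NeZero M] (y : ZMod M) (x : ℤ) :
    ZMod.stdAddChar (-(y * (x : ZMod M))) = ratExp (-(y.val : ℚ) / M) x := by
  have : -(y * (x : ZMod M)) = ((-(y.val * x) : ℤ) : ZMod M) := by
    push_cast
    rw [ZMod.natCast_zmod_val]
  rw [this, ZMod.stdAddChar_coe]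
  unfold ratExp
  congr 1
  push_cast
  ring

lemma char_expansion {M : ℕ} [NeZero M] (χ : DirichletCharacter ℂ M) (h : χ.IsPrimitive) (x : ℤ) :
    χ (x : ZMod M) = gaussSumStd χ * ∑ y : ZMod M, (χ⁻¹ y / M) * ratExp (-(y.val : ℚ) / M) x := by
  have hM : (M : ℂ) ≠ 0 := by exact_mod_cast NeZero.ne M
  have h1 : ∑ y : ZMod M, gaussSum χ (ZMod.stdAddChar.mulShift y)
      * ZMod.stdAddChar (-(y * (x : ZMod M))) = M * χ (x : ZMod M) := by
    simp only [gaussSum, Finset.sum_mul]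
    rw [Finset.sum_comm]
    have : ∀ a : ZMod M, ∑ y : ZMod M, χ a * (ZMod.stdAddChar.mulShift y) a
        * ZMod.stdAddChar (-(y * (x : ZMod M))) = if a = (x : ZMod M) then M * χ (x : ZMod M) else 0 := by
      intro a
      have e : ∀ y : ZMod M, χ a * (ZMod.stdAddChar.mulShift y) a
        * ZMod.stdAddChar (-(y * (x : ZMod M))) = χ a * ZMod.stdAddChar (y * (a - (x : ZMod M))) := by
        intro y
        rw [AddChar.mulShift_apply, mul_assoc, ← AddChar.map_add_eq_mul]
        congr 2
        ring
      simp only [e]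
      rw [← Finset.mul_sum, AddChar.sum_mulShift _ (ZMod.isPrimitive_stdAddChar M)]
      by_cases hax : a = (x : ZMod M)
      · simp [hax, ZMod.card, mul_comm]
      · simp [hax, sub_eq_zero]
    simp only [this]
    simp
  simp only [gaussSum_mulShift_of_isPrimitive _ h, stdAddChar_ratExp] at h1
  unfold gaussSumStd
  rw [eq_comm, ← mul_right_inj' hM, ← h1]
  simp only [Finset.mul_sum]
  refine Finset.sum_congr rfl fun y _ => ?_
  field_simp

lemma twist_prod_apply {M N : ℕ} [NeZero M] [NeZero N]
    (χ : DirichletCharacter ℂ M) (ψ : DirichletCharacter ℂ N) (x : ℤ) :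
    (changeLevel (Nat.dvd_lcm_left M N) χ * changeLevel (Nat.dvd_lcm_right M N) ψ)
      (x : ZMod (Nat.lcm M N)) = χ (x : ZMod M) * ψ (x : ZMod N) := by
  by_cases hx : IsCoprime x (Nat.lcm M N : ℤ)
  · rw [MulChar.mul_apply, changeLevel_eq_cast_of_dvd' _ _ hx, changeLevel_eq_cast_of_dvd' _ _ hx]
  · rw [MulChar.map_nonunit _ (by rwa [ZMod.coe_int_isUnit_iff_isCoprime, isCoprime_comm])]
    by_cases h1 : IsCoprime x (M : ℤ)
    · by_cases h2 : IsCoprime x (N : ℤ)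
      · refine absurd ?_ hx
        refine (h1.mul_right h2).of_isCoprime_of_dvd_right ?_
        exact_mod_cast Nat.lcm_dvd_mul M N
      · rw [MulChar.map_nonunit ψ (by rwa [ZMod.coe_int_isUnit_iff_isCoprime, isCoprime_comm]),
          mul_zero]
    · rw [MulChar.map_nonunit χ (by rwa [ZMod.coe_int_isUnit_iff_isCoprime, isCoprime_comm]),
        zero_mul]

theorem lvalue_twist_stable {M N : ℕ} [NeZero M] [NeZero N]
    (χ : DirichletCharacter ℂ M) (ψ : DirichletCharacter ℂ N)
    (hχprim : χ.IsPrimitive) (hχeven : χ.Even) (hψprim : ψ.IsPrimitive)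
    (m : ℤ) (hm : m < 0) (hcrit : ψ (-1) = (-1 : ℂ) ^ (m + 1)) :
    ∃ k ∈ Subfield.closure (Set.range χ ∪ Set.range ψ : Set ℂ),
      DirichletCharacter.LFunction
        (changeLevel (Nat.dvd_lcm_left M N) χ * changeLevel (Nat.dvd_lcm_right M N) ψ)
        (1 - (m : ℂ)) =
      k * gaussSumStd χ * DirichletCharacter.LFunction ψ (1 - (m : ℂ)) := by
  obtain ⟨n, hn⟩ : ∃ n : ℕ, (n : ℤ) = 1 - m := ⟨(1 - m).toNat, by lia⟩
  have hn2 : 2 ≤ n := by lia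
  obtain rfl : m = 1 - n := by lia
  have hs : (1 : ℂ) - ((1 - n : ℤ) : ℂ) = n := by push_cast; ring
  have hs1 : 1 < (n : ℂ).re := by
    rw [Complex.natCast_re]; exact_mod_cast (by lia : 1 < n)
  have hψpar : ψ (-1) = (-1) ^ n := by
    rw [hcrit, show (1 - n + 1 : ℤ) = 2 - n by ring, zpow_sub₀ (by norm_num)]
    rcases neg_one_pow_eq_or ℂ n with h | h <;> simp [h]
  rw [hs]
  set K := Subfield.closure (Set.range χ ∪ Set.range ψ : Set ℂ) with hK
  have hcχ : ∀ y, χ⁻¹ y / M ∈ K := fun y => by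
    rw [MulChar.inv_apply_eq_inv']
    exact div_mem (inv_mem (Subfield.subset_closure (Or.inl ⟨y, rfl⟩))) (natCast_mem K M)
  have hcψ : ∀ y, ψ⁻¹ y / N ∈ K := fun y => by
    rw [MulChar.inv_apply_eq_inv']
    exact div_mem (inv_mem (Subfield.subset_closure (Or.inr ⟨y, rfl⟩))) (natCast_mem K N)
  have hψneg : ∀ x : ℤ, ψ ((-x : ℤ) : ZMod N) = (-1) ^ n * ψ (x : ZMod N) := fun x => by
    rw [Int.cast_neg, ← neg_one_mul, map_mul, hψpar]
  have hχneg : ∀ x : ℤ, χ ((-x : ℤ) : ZMod M) = χ (x : ZMod M) := fun x => by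
    rw [Int.cast_neg, ← neg_one_mul, map_mul, hχeven, one_mul]
  obtain ⟨k2, hk2, e2⟩ := lseries_rational hn2 K (fun y => ψ⁻¹ y / N) hcψ
    (fun y => -(y.val : ℚ) / N) (gaussSumStd ψ) (fun x : ℤ => ψ (x : ZMod N))
    (char_expansion ψ hψprim) hψneg
  obtain ⟨k1, hk1, e1⟩ := lseries_rational hn2 K
    (fun p : ZMod M × ZMod N => (χ⁻¹ p.1 / M) * (ψ⁻¹ p.2 / N))
    (fun p => mul_mem (hcχ p.1) (hcψ p.2))
    (fun p => -(p.1.val : ℚ) / M + -(p.2.val : ℚ) / N) (gaussSumStd χ * gaussSumStd ψ)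
    (fun x : ℤ => χ (x : ZMod M) * ψ (x : ZMod N))
    (fun x => by
      rw [char_expansion χ hχprim, char_expansion ψ hψprim, mul_mul_mul_comm, Finset.sum_mul_sum,
        Fintype.sum_prod_type]
      congr 1
      refine Finset.sum_congr rfl fun a _ => Finset.sum_congr rfl fun b _ => ?_
      rw [ratExp_add]
      ring)
    (fun x => by rw [hψneg, hχneg]; ring)
  have hne : LFunction ψ (n : ℂ) ≠ 0 :=
    LFunction_ne_zero_of_one_le_re ψ (Or.inr (by exact_mod_cast (by lia : n ≠ 1))) hs1.le
  rw [LFunction_eq_LSeries _ hs1] at hne ⊢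
  rw [LFunction_eq_LSeries _ hs1]
  have f2 : LSeries (fun x : ℕ => ψ (x : ZMod N)) n
      = gaussSumStd ψ * (2 * Real.pi * I) ^ n * k2 := by
    rw [← e2]; simp
  have f1 : LSeries (fun x : ℕ => (changeLevel (Nat.dvd_lcm_left M N) χ *
      changeLevel (Nat.dvd_lcm_right M N) ψ) (x : ZMod (Nat.lcm M N))) n
      = gaussSumStd χ * gaussSumStd ψ * (2 * Real.pi * I) ^ n * k1 := by
    rw [← e1]
    congr 1
    funext x
    rw [← twist_prod_apply]
    simp
  rw [f2] at hne
  have hk0 : k2 ≠ 0 := right_ne_zero_of_mul hne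
  refine ⟨k1 / k2, div_mem hk1 hk2, ?_⟩
  rw [f1, f2]
  field_simp
end

section
/- Let χ be a primitive even Dirichlet character modulo M and ψ a primitive Dirichlet character modulo N, and let m be a negative integer with ψ(−1) = (−1)^{m+1}. Let χ̄ψ̄ denote the Dirichlet character modulo lcm(M,N) obtained as the product of the extensions of the conjugate characters χ̄ and ψ̄ to modulus lcm(M,N). Then there exists k ∈ ℚ(χ,ψ) such that τ(χ) · L(χ̄ψ̄, 1−m) = k · L(ψ̄, 1−m). -/
open Complex DirichletCharacter

lemma aux_exp_fract (q : ℚ) (z : ℤ) :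
    Complex.exp (2 * Real.pi * Complex.I * z * ((Int.fract q : ℚ) : ℂ)) =
      Complex.exp (2 * Real.pi * Complex.I * z * (q : ℂ)) := by
  rw [Complex.exp_eq_exp_iff_exists_int]
  refine ⟨-(z * ⌊q⌋), ?_⟩
  have : ((Int.fract q : ℚ) : ℂ) = (q : ℂ) - (⌊q⌋ : ℤ) := by
    rw [Int.fract]; push_cast; ring
  rw [this]; push_cast; ring

lemma aux_bernoulli (k : ℕ) (q : ℚ) :
    ((bernoulliFun k (q : ℝ) : ℝ) : ℂ) = (((Polynomial.bernoulli k).eval q : ℚ) : ℂ) := by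
  have : bernoulliFun k (q : ℝ) = (((Polynomial.bernoulli k).eval q : ℚ) : ℝ) := by
    rw [bernoulliFun]
    have := Polynomial.eval_map_apply (p := Polynomial.bernoulli k) (algebraMap ℚ ℝ) q
    simpa using this
  rw [this]; push_cast; rfl

lemma aux_key (K : Subfield ℂ) {ι : Type*} [Fintype ι] (c : ι → ℂ) (hc : ∀ i, c i ∈ K)
    (x : ι → ℚ) {k : ℕ} (hk : 2 ≤ k) (f : ℤ → ℂ)
    (h1 : ∀ z, f z = ∑ i, c i * Complex.exp (2 * Real.pi * Complex.I * z * (x i : ℂ)))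
    (h2 : ∀ z, f (-z) = (-1 : ℂ) ^ k * f z) :
    ∃ y ∈ K, ∑' n : ℕ, (1 : ℂ) / (n : ℂ) ^ k * f n = (2 * Real.pi * Complex.I) ^ k * y := by
  have H : ∀ i, HasSum (fun n : ℕ => c i * ((1 : ℂ) / (n : ℂ) ^ k *
      (Complex.exp (2 * Real.pi * Complex.I * (n : ℤ) * (x i : ℂ)) +
        (-1 : ℂ) ^ k * Complex.exp (2 * Real.pi * Complex.I * (-(n : ℤ) : ℤ) * (x i : ℂ)))))
      (c i * (-(2 * Real.pi * Complex.I) ^ k / k.factorial *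
        (((Polynomial.bernoulli k).eval (Int.fract (x i)) : ℚ) : ℂ))) := by
    intro i
    apply HasSum.mul_left
    have hx : ((Int.fract (x i) : ℚ) : ℝ) ∈ Set.Icc (0 : ℝ) 1 :=
      ⟨by exact_mod_cast Int.fract_nonneg (x i), by exact_mod_cast (Int.fract_lt_one (x i)).le⟩
    have h := hasSum_one_div_nat_pow_mul_fourier hk hx
    rw [aux_bernoulli] at h
    convert! h using 1
    funext n
    rw [fourier_coe_apply, fourier_coe_apply, ← aux_exp_fract, ← aux_exp_fract (x i) (-n)]
    simp only [Complex.ofReal_ratCast, Complex.ofReal_one, div_one]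
  have H2 := hasSum_sum (fun i (_ : i ∈ Finset.univ) => H i)
  have e : ∀ n : ℕ, ∑ i, c i * ((1 : ℂ) / (n : ℂ) ^ k *
      (Complex.exp (2 * Real.pi * Complex.I * (n : ℤ) * (x i : ℂ)) +
        (-1 : ℂ) ^ k * Complex.exp (2 * Real.pi * Complex.I * (-(n : ℤ) : ℤ) * (x i : ℂ))))
      = 2 * ((1 : ℂ) / (n : ℂ) ^ k * f n) := by
    intro n
    have a : (-1 : ℂ) ^ k * f (-(n : ℤ)) = f n := by
      rw [h2, ← mul_assoc, ← mul_pow]; simp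
    have b : 2 * ((1 : ℂ) / (n : ℂ) ^ k * f n) =
      (1 : ℂ) / (n : ℂ) ^ k * (f n + (-1 : ℂ) ^ k * f (-(n : ℤ))) := by rw [a]; ring
    rw [b, h1, h1, Finset.mul_sum, ← Finset.sum_add_distrib, Finset.mul_sum]
    refine Finset.sum_congr rfl fun i _ => ?_
    ring
  simp_rw [e] at H2
  have H3 := (H2.mul_left (1 / 2 : ℂ)).tsum_eq
  refine ⟨(1 / 2) * ∑ i, c i * (-1 / k.factorial *
        (((Polynomial.bernoulli k).eval (Int.fract (x i)) : ℚ) : ℂ)), ?_, ?_⟩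
  · refine K.mul_mem (by simp) (K.sum_mem fun i _ => ?_)
    refine K.mul_mem (hc i) (K.mul_mem (K.div_mem (K.neg_mem K.one_mem) (natCast_mem K _)) ?_)
    exact SubfieldClass.ratCast_mem K _
  · trans ∑' n : ℕ, (1 / 2 : ℂ) * (2 * ((1 : ℂ) / (n : ℂ) ^ k * f n))
    · refine tsum_congr fun n => by ring
    · rw [H3, Finset.mul_sum, Finset.mul_sum, Finset.mul_sum]
      refine Finset.sum_congr rfl fun i _ => by ring

lemma aux_gauss {N : ℕ} [NeZero N] {ψ : DirichletCharacter ℂ N} (hψ : ψ.IsPrimitive) (z : ℤ) :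
    gaussSumStd ψ * ψ⁻¹ (z : ZMod N) =
      ∑ a : ZMod N, ψ a * Complex.exp (2 * Real.pi * Complex.I * z * (((a.val : ℚ) / N : ℚ) : ℂ)) := by
  rw [gaussSumStd, mul_comm, ← gaussSum_mulShift_of_isPrimitive _ hψ, gaussSum]
  refine Finset.sum_congr rfl fun a _ => ?_
  rw [AddChar.mulShift_apply]
  have : (z : ZMod N) * a = ((z * a.val : ℤ) : ZMod N) := by simp
  rw [this, ZMod.stdAddChar_coe]
  congr 2
  push_cast; ring

lemma aux_gauss_ne {N : ℕ} [NeZero N] {ψ : DirichletCharacter ℂ N} (hψ : ψ.IsPrimitive) :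
    gaussSumStd ψ ≠ 0 := by
  intro h
  rw [gaussSumStd] at h
  have : ZMod.dft (ψ : ZMod N → ℂ) = 0 := by
    ext k
    rw [hψ.fourierTransform_eq_inv_mul_gaussSum, h]; simp
  have h3 : (ψ : ZMod N → ℂ) = 0 := by simpa using this
  have := congrFun h3 1
  simp at this

lemma aux_L {N : ℕ} [NeZero N] (ψ : DirichletCharacter ℂ N) {k : ℕ} (hk : 2 ≤ k) :
    DirichletCharacter.LFunction ψ k = ∑' n : ℕ, (1 : ℂ) / (n : ℂ) ^ k * ψ (n : ZMod N) := by
  rw [DirichletCharacter.LFunction_eq_LSeries _ (by simp; omega), LSeries]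
  refine tsum_congr fun n => ?_
  rw [LSeries.term_def]
  split_ifs with h
  · subst h; simp [show k ≠ 0 by omega]
  · rw [Complex.cpow_natCast]; ring

lemma aux_conj {N : ℕ} (ψ : DirichletCharacter ℂ N) :
    ψ.ringHomComp (starRingEnd ℂ) = ψ⁻¹ := MulChar.star_eq_inv ψ

lemma aux_lcm {M N : ℕ} [NeZero M] [NeZero N]
    (χ : DirichletCharacter ℂ M) (ψ : DirichletCharacter ℂ N) (n : ℕ) :
    (changeLevel (Nat.dvd_lcm_left M N) χ * changeLevel (Nat.dvd_lcm_right M N) ψ)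
      (n : ZMod (Nat.lcm M N)) = χ (n : ZMod M) * ψ (n : ZMod N) := by
  rw [MulChar.mul_apply]
  by_cases h : IsUnit (n : ZMod (Nat.lcm M N))
  · have h1 := changeLevel_eq_cast_of_dvd χ (Nat.dvd_lcm_left M N) h.unit
    have h2 := changeLevel_eq_cast_of_dvd ψ (Nat.dvd_lcm_right M N) h.unit
    rw [h.unit_spec] at h1 h2
    rw [h1, h2, ZMod.cast_natCast (Nat.dvd_lcm_left M N), ZMod.cast_natCast (Nat.dvd_lcm_right M N)]
  · rw [MulChar.map_nonunit _ h, zero_mul]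
    rw [ZMod.isUnit_iff_coprime] at h
    by_cases hM : IsUnit (n : ZMod M)
    · by_cases hN : IsUnit (n : ZMod N)
      · rw [ZMod.isUnit_iff_coprime] at hM hN
        exact absurd (Nat.Coprime.coprime_dvd_right (Nat.lcm_dvd_mul M N) (hM.mul_right hN)) h
      · rw [MulChar.map_nonunit _ hN, mul_zero]
    · rw [MulChar.map_nonunit _ hM, zero_mul]

theorem gauss_sum_times_conj_lvalue {M N : ℕ} [NeZero M] [NeZero N]
    (χ : DirichletCharacter ℂ M) (ψ : DirichletCharacter ℂ N)
    (hχprim : χ.IsPrimitive) (hχeven : χ.Even) (hψprim : ψ.IsPrimitive)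
    (m : ℤ) (hm : m < 0) (hcrit : ψ (-1) = (-1 : ℂ) ^ (m + 1)) :
    ∃ k ∈ Subfield.closure (Set.range χ ∪ Set.range ψ : Set ℂ),
      gaussSumStd χ *
        DirichletCharacter.LFunction
          (changeLevel (Nat.dvd_lcm_left M N) (χ.ringHomComp (starRingEnd ℂ)) *
            changeLevel (Nat.dvd_lcm_right M N) (ψ.ringHomComp (starRingEnd ℂ)))
          (1 - (m : ℂ)) =
      k * DirichletCharacter.LFunction (ψ.ringHomComp (starRingEnd ℂ)) (1 - (m : ℂ)) := by
  obtain ⟨s, hs⟩ : ∃ s : ℕ, (s : ℤ) = 1 - m := ⟨(1 - m).toNat, by omega⟩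
  have hs2 : 2 ≤ s := by omega
  have hsc : (1 - (m : ℂ)) = (s : ℂ) := by
    have : ((s : ℤ) : ℂ) = ((1 - m : ℤ) : ℂ) := by rw [hs]
    push_cast at this; exact this.symm
  have hψ1 : ψ (-1) = (-1 : ℂ) ^ s := by
    rw [hcrit, show m + 1 = 2 + -(s : ℤ) by omega, zpow_add₀ (by norm_num), zpow_neg,
      zpow_natCast, ← inv_pow]
    norm_num
  have hψi : ψ⁻¹ (-1) = (-1 : ℂ) ^ s := by
    rw [MulChar.inv_apply_eq_inv', hψ1, ← inv_pow]; norm_num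
  have hχi : χ⁻¹ (-1) = 1 := by
    rw [MulChar.inv_apply_eq_inv', hχeven]; norm_num
  rw [hsc, aux_conj, aux_conj]
  set K := Subfield.closure (Set.range χ ∪ Set.range ψ : Set ℂ) with hK
  have hχK : ∀ a, χ a ∈ K := fun a => Subfield.subset_closure (Or.inl ⟨a, rfl⟩)
  have hψK : ∀ a, ψ a ∈ K := fun a => Subfield.subset_closure (Or.inr ⟨a, rfl⟩)
  have hψneg : ∀ z : ℤ, ψ⁻¹ ((-z : ℤ) : ZMod N) = (-1 : ℂ) ^ s * ψ⁻¹ (z : ZMod N) := by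
    intro z
    rw [← hψi, ← map_mul]; congr 1; push_cast; ring
  have hχneg : ∀ z : ℤ, χ⁻¹ ((-z : ℤ) : ZMod M) = χ⁻¹ (z : ZMod M) := by
    intro z
    rw [← one_mul (χ⁻¹ (z : ZMod M)), ← hχi, ← map_mul]; congr 1; push_cast; ring
  obtain ⟨y2, hy2, e2⟩ := aux_key K (fun a : ZMod N => ψ a) hψK
    (fun a => (a.val : ℚ) / N) hs2 (fun z => gaussSumStd ψ * ψ⁻¹ (z : ZMod N))
    (fun z => aux_gauss hψprim z) (fun z => by simp only [hψneg]; ring)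
  obtain ⟨y1, hy1, e1⟩ := aux_key K (fun p : ZMod M × ZMod N => χ p.1 * ψ p.2)
    (fun p => K.mul_mem (hχK _) (hψK _))
    (fun p => (p.1.val : ℚ) / M + (p.2.val : ℚ) / N) hs2
    (fun z => (gaussSumStd χ * χ⁻¹ (z : ZMod M)) * (gaussSumStd ψ * ψ⁻¹ (z : ZMod N)))
    (fun z => by
      rw [aux_gauss hχprim z, aux_gauss hψprim z, Finset.sum_mul_sum, Fintype.sum_prod_type]
      refine Finset.sum_congr rfl fun a _ => Finset.sum_congr rfl fun b _ => ?_
      rw [Rat.cast_add, mul_add, Complex.exp_add]; ring)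
    (fun z => by simp only [hψneg, hχneg]; ring)
  have E2 : gaussSumStd ψ * DirichletCharacter.LFunction ψ⁻¹ s =
      (2 * Real.pi * Complex.I) ^ s * y2 := by
    rw [← e2, aux_L _ hs2, ← tsum_mul_left]
    refine tsum_congr fun n => ?_
    push_cast; ring
  have E1 : gaussSumStd ψ * (gaussSumStd χ * DirichletCharacter.LFunction
      (changeLevel (Nat.dvd_lcm_left M N) χ⁻¹ * changeLevel (Nat.dvd_lcm_right M N) ψ⁻¹) s) =
      (2 * Real.pi * Complex.I) ^ s * y1 := by
    rw [← e1, aux_L _ hs2, ← tsum_mul_left, ← tsum_mul_left]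
    refine tsum_congr fun n => ?_
    rw [aux_lcm]
    push_cast; ring
  have hτ := aux_gauss_ne hψprim
  have hC : (2 * Real.pi * Complex.I) ^ s ≠ 0 := pow_ne_zero _ Complex.two_pi_I_ne_zero
  have hL : DirichletCharacter.LFunction ψ⁻¹ (s : ℂ) ≠ 0 := by
    rw [DirichletCharacter.LFunction_eq_LSeries _ (by simp; omega)]
    exact DirichletCharacter.LSeries_ne_zero_of_one_lt_re _ (by simp; omega)
  have hy : y2 ≠ 0 := by
    rintro rfl
    rw [mul_zero] at E2
    exact mul_ne_zero hτ hL E2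
  refine ⟨y1 / y2, K.div_mem hy1 hy2, ?_⟩
  apply mul_left_cancel₀ hτ
  rw [E1, mul_left_comm, E2]
  field_simp
end

section
/- Let ψ be a Dirichlet character modulo N and let m be a negative integer. Then L(ψ, m) lies in ℚ(ψ), the subfield of ℂ generated over ℚ by the values of ψ. -/
open Complex DirichletCharacter

theorem lvalue_mem_field_of_values {N : ℕ} [NeZero N]
    (ψ : DirichletCharacter ℂ N) (m : ℤ) (hm : m < 0) :
    DirichletCharacter.LFunction ψ (m : ℂ) ∈ Subfield.closure (Set.range ψ : Set ℂ) := by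
  obtain ⟨k, rfl⟩ : ∃ k : ℕ, m = -(k : ℤ) := ⟨m.natAbs, by omega⟩
  have hk : k ≠ 0 := by omega
  have hcast : (((-(k : ℤ)) : ℤ) : ℂ) = -(k : ℂ) := by push_cast; rfl
  rw [hcast, DirichletCharacter.LFunction, ZMod.LFunction, neg_neg, Complex.cpow_natCast]
  refine mul_mem (pow_mem (natCast_mem _ N) k) (sum_mem fun j _ => ?_)
  refine mul_mem (Subfield.subset_closure ⟨j, rfl⟩) ?_
  have hx : (j.val / N : ℝ) ∈ Set.Icc (0 : ℝ) 1 := Set.mem_Icc.mpr ⟨by positivity,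
    (div_le_one (Nat.cast_pos.mpr <| NeZero.pos _)).mpr <| Nat.cast_le.mpr (ZMod.val_lt j).le⟩
  rw [ZMod.toAddCircle_apply, HurwitzZeta.hurwitzZeta_neg_nat hk hx]
  have h1 : (((j.val / N : ℝ)) : ℂ) = algebraMap ℚ ℂ ((j.val : ℚ) / N) := by
    rw [eq_ratCast]; push_cast; rfl
  rw [h1, Polynomial.eval_map_algebraMap, Polynomial.aeval_algebraMap_apply]
  have h2 : (-1 / ((k : ℂ) + 1)) = algebraMap ℚ ℂ (-1 / ((k : ℚ) + 1)) := by simp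
  rw [h2, ← map_mul]
  exact SubfieldClass.ratCast_mem _ _
end

section
/- Let ψ be a Dirichlet character modulo N, let m be a negative integer, and let σ be any field automorphism of ℂ. Then σ(L(ψ, m)) = L(σ∘ψ, m), where σ∘ψ is the Dirichlet character modulo N obtained by composing ψ with σ. -/
open Complex DirichletCharacter

lemma hurwitz_rat_aux {N : ℕ} [NeZero N] (j : ZMod N) (k : ℕ) (hk : k ≠ 0) :
    ∃ q : ℚ, HurwitzZeta.hurwitzZeta (ZMod.toAddCircle j) (-(k : ℂ)) = (q : ℂ) := by
  have hN : (0 : ℝ) < N := by exact_mod_cast Nat.pos_of_ne_zero (NeZero.ne N)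
  have hx : ((j.val : ℝ) / N) ∈ Set.Icc (0 : ℝ) 1 := by
    refine ⟨by positivity, ?_⟩
    rw [div_le_one hN]
    exact_mod_cast (ZMod.val_lt j).le
  rw [ZMod.toAddCircle_apply, HurwitzZeta.hurwitzZeta_neg_nat hk hx]
  refine ⟨-1 / (k + 1) * (Polynomial.bernoulli (k + 1)).eval ((j.val : ℚ) / N), ?_⟩
  have h : (((j.val : ℝ) / N : ℝ) : ℂ) = algebraMap ℚ ℂ ((j.val : ℚ) / N) := by
    rw [map_div₀, map_natCast, map_natCast, ofReal_div, ofReal_natCast, ofReal_natCast]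
  rw [h, Polynomial.eval_map_apply]
  simp

theorem lvalue_galois_equivariant {N : ℕ} [NeZero N]
    (ψ : DirichletCharacter ℂ N) (m : ℤ) (hm : m < 0) (σ : ℂ ≃+* ℂ) :
    σ (DirichletCharacter.LFunction ψ (m : ℂ)) =
      DirichletCharacter.LFunction (ψ.ringHomComp (σ : ℂ →+* ℂ)) (m : ℂ) := by
  obtain ⟨k, rfl⟩ : ∃ k : ℕ, m = -(k : ℤ) := ⟨m.natAbs, by omega⟩
  have hk : k ≠ 0 := by omega
  have hc : ((-(k : ℤ) : ℤ) : ℂ) = -(k : ℂ) := by push_cast; rfl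
  rw [hc]
  unfold DirichletCharacter.LFunction ZMod.LFunction
  have hp : ((N : ℂ) ^ (-(-(k : ℂ)))) = (N : ℂ) ^ k := by
    rw [neg_neg, cpow_natCast]
  rw [hp, map_mul, map_pow, map_natCast, map_sum]
  congr 1
  refine Finset.sum_congr rfl fun j _ => ?_
  obtain ⟨q, hq⟩ := hurwitz_rat_aux j k hk
  rw [hq, map_mul, map_ratCast]
  rfl
end

section
/- Let χ be a primitive Dirichlet character modulo M and ψ a primitive Dirichlet character modulo N, and let χψ denote the Dirichlet character modulo lcm(M,N) obtained as the product of the extensions of χ and ψ to modulus lcm(M,N). Then τ(χψ) / (τ(χ) · τ(ψ)) lies in ℚ(χ,ψ), the subfield of ℂ generated over ℚ by the values of χ and ψ. (Note τ(χ) and τ(ψ) are nonzero since χ and ψ are primitive.) -/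
open Complex DirichletCharacter

lemma gsr_std_pow {n L : ℕ} [NeZero n] [NeZero L] (h : n ∣ L) (k : ℕ) :
    (ZMod.stdAddChar (1 : ZMod L) : ℂ) ^ (k * (L / n)) = ZMod.stdAddChar (k : ZMod n) := by
  obtain ⟨m, rfl⟩ := h
  have hn : 0 < n := Nat.pos_of_ne_zero (NeZero.ne n)
  have hm : (m : ℂ) ≠ 0 := by
    have := NeZero.ne (n * m)
    exact_mod_cast (mul_ne_zero_iff.mp this).2
  have hn' : (n : ℂ) ≠ 0 := by exact_mod_cast hn.ne'
  rw [Nat.mul_div_cancel_left _ hn]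
  have h1 := ZMod.stdAddChar_coe (N := n * m) 1
  have h2 := ZMod.stdAddChar_coe (N := n) k
  rw [Int.cast_one] at h1
  rw [Int.cast_natCast] at h2
  rw [h1, h2, ← Complex.exp_nat_mul]
  congr 1
  push_cast
  field_simp

lemma gsr_key {n L a : ℕ} [NeZero n] [NeZero L] (h : n ∣ L) (ha : a.Coprime L)
    (χ : DirichletCharacter ℂ n) {E : Type*} [Field E] (i f : E →+* ℂ) (z : E)
    (hz : i z = ZMod.stdAddChar (1 : ZMod L)) (hfz : f z = (i z) ^ a) (c : ZMod n → E)
    (hi : ∀ x, i (c x) = χ x) (hf : ∀ x, f (c x) = χ x) :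
    ∃ t : E, i t = gaussSumStd χ ∧ χ a * f t = gaussSumStd χ := by
  refine ⟨∑ x, c x * z ^ (x.val * (L / n)), ?_, ?_⟩
  · rw [map_sum, gaussSumStd, gaussSum]
    refine Finset.sum_congr rfl fun x _ => ?_
    rw [map_mul, map_pow, hi, hz, gsr_std_pow h, ZMod.natCast_zmod_val]
  · have hu := gaussSum_mulShift χ ZMod.stdAddChar
      (ZMod.unitOfCoprime a (ha.coprime_dvd_right h))
    rw [ZMod.coe_unitOfCoprime] at hu
    rw [gaussSumStd, ← hu]
    congr 1
    rw [map_sum, gaussSum]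
    refine Finset.sum_congr rfl fun x _ => ?_
    rw [map_mul, map_pow, hf, hfz, hz, ← pow_mul, ← mul_assoc, gsr_std_pow h,
      AddChar.mulShift_apply, Nat.cast_mul, ZMod.natCast_zmod_val]

theorem gauss_sum_ratio_mem_field {M N : ℕ} [NeZero M] [NeZero N]
    (χ : DirichletCharacter ℂ M) (ψ : DirichletCharacter ℂ N)
    (hχprim : χ.IsPrimitive) (hψprim : ψ.IsPrimitive) :
    gaussSumStd (changeLevel (Nat.dvd_lcm_left M N) χ * changeLevel (Nat.dvd_lcm_right M N) ψ) /
        (gaussSumStd χ * gaussSumStd ψ) ∈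
      Subfield.closure (Set.range χ ∪ Set.range ψ : Set ℂ) := by
  set K := Subfield.closure (Set.range χ ∪ Set.range ψ : Set ℂ) with hK
  have hχK : ∀ x, χ x ∈ K := fun x => Subfield.subset_closure (Or.inl ⟨x, rfl⟩)
  have hψK : ∀ x, ψ x ∈ K := fun x => Subfield.subset_closure (Or.inr ⟨x, rfl⟩)
  set L := Nat.lcm M N with hL
  set θ := changeLevel (Nat.dvd_lcm_left M N) χ * changeLevel (Nat.dvd_lcm_right M N) ψ with hθ
  have hθu : ∀ a : ℕ, a.Coprime L → θ a = χ a * ψ a := by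
    intro a ha
    have h1 := changeLevel_eq_cast_of_dvd χ (Nat.dvd_lcm_left M N) (ZMod.unitOfCoprime a ha)
    have h2 := changeLevel_eq_cast_of_dvd ψ (Nat.dvd_lcm_right M N) (ZMod.unitOfCoprime a ha)
    rw [ZMod.coe_unitOfCoprime, ZMod.cast_natCast (Nat.dvd_lcm_left M N)] at h1
    rw [ZMod.coe_unitOfCoprime, ZMod.cast_natCast (Nat.dvd_lcm_right M N)] at h2
    rw [hθ, MulChar.mul_apply, h1, h2]
  have hθK : ∀ x, θ x ∈ K := by
    intro x
    by_cases hx : IsUnit x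
    · have hc : x.val.Coprime L := by
        rw [← ZMod.isUnit_iff_coprime, ZMod.natCast_zmod_val]; exact hx
      have := hθu x.val hc
      rw [ZMod.natCast_zmod_val] at this
      rw [this]
      exact mul_mem (hχK _) (hψK _)
    · rw [MulChar.map_nonunit _ hx]; exact zero_mem _
  set ζ : ℂ := ZMod.stdAddChar (1 : ZMod L) with hζ
  have hprim : IsPrimitiveRoot ζ L := by
    have h1 := ZMod.stdAddChar_coe (N := L) 1
    rw [Int.cast_one] at h1
    rw [hζ, h1]
    simpa using Complex.isPrimitiveRoot_exp L (NeZero.ne L)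
  let E := IntermediateField.adjoin K {ζ}
  have : IsCyclotomicExtension {L} K E :=
    (IntermediateField.isCyclotomicExtension_singleton_iff_eq_adjoin L K ℂ E hprim).mpr rfl
  have : IsGalois K E := IsCyclotomicExtension.isGalois {L} K E
  have : FiniteDimensional K E := IsCyclotomicExtension.finiteDimensional {L} K E
  let z : E := ⟨ζ, IntermediateField.mem_adjoin_simple_self K ζ⟩
  have hzprim : IsPrimitiveRoot z L := by
    apply IsPrimitiveRoot.of_map_of_injective (f := E.val) hprim E.val.injective
  have key : ∀ {n : ℕ} [NeZero n] (hn : n ∣ L) (φ : DirichletCharacter ℂ n),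
      (∀ x, φ x ∈ K) → ∃ t : E, (t : ℂ) = gaussSumStd φ ∧
        ∀ (σ : E ≃ₐ[K] E) (a : ℕ), a.Coprime L → σ z = z ^ a →
          φ a * (σ t : ℂ) = gaussSumStd φ := by
    intro n _ hn φ hφ
    have aux : ∀ (σ : E ≃ₐ[K] E) (a : ℕ), a.Coprime L → σ z = z ^ a →
        ∃ t : E, (t : ℂ) = gaussSumStd φ ∧ φ a * (σ t : ℂ) = gaussSumStd φ := by
      intro σ a ha hσ
      refine gsr_key hn ha φ (E.val : E →+* ℂ) ((E.val.comp (σ : E →ₐ[K] E)) : E →+* ℂ) z rfl ?_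
        (fun x => algebraMap K E ⟨φ x, hφ x⟩) (fun x => rfl) (fun x => ?_)
      · change ((σ z : E) : ℂ) = _
        rw [hσ]; rfl
      · change ((σ (algebraMap K E ⟨φ x, hφ x⟩) : E) : ℂ) = _
        rw [σ.commutes]; rfl
    obtain ⟨t, ht, -⟩ := aux 1 1 (Nat.coprime_one_left L) (by simp)
    refine ⟨t, ht, fun σ a ha hσ => ?_⟩
    obtain ⟨t', ht', h'⟩ := aux σ a ha hσ
    have : t = t' := Subtype.ext (ht.trans ht'.symm)
    rw [this]; exact h'
  obtain ⟨t₁, h₁, g₁⟩ := key (Nat.dvd_lcm_left M N) χ hχK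
  obtain ⟨t₂, h₂, g₂⟩ := key (Nat.dvd_lcm_right M N) ψ hψK
  obtain ⟨t₃, h₃, g₃⟩ := key dvd_rfl θ hθK
  have hfix : ∀ σ : E ≃ₐ[K] E, σ (t₃ / (t₁ * t₂)) = t₃ / (t₁ * t₂) := by
    intro σ
    obtain ⟨a, -, ha, hσ⟩ := hzprim.isPrimitiveRoot_iff.mp
      (hzprim.map_of_injective (f := σ) σ.injective)
    have e₁ := g₁ σ a ha hσ.symm
    have e₂ := g₂ σ a ha hσ.symm
    have e₃ := g₃ σ a ha hσ.symm
    have u₁ : χ a ≠ 0 := (((ZMod.isUnit_iff_coprime a M).mpr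
      (ha.coprime_dvd_right (Nat.dvd_lcm_left M N))).map χ).ne_zero
    have u₂ : ψ a ≠ 0 := (((ZMod.isUnit_iff_coprime a N).mpr
      (ha.coprime_dvd_right (Nat.dvd_lcm_right M N))).map ψ).ne_zero
    apply Subtype.ext
    rw [map_div₀, map_mul]
    change (σ t₃ : ℂ) / ((σ t₁ : ℂ) * (σ t₂ : ℂ)) = (t₃ : ℂ) / ((t₁ : ℂ) * (t₂ : ℂ))
    rw [h₁, h₂, h₃, ← e₁, ← e₂, ← e₃, hθu a ha, mul_mul_mul_comm,
      mul_div_mul_left _ _ (mul_ne_zero u₁ u₂)]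
  obtain ⟨k, hk⟩ := IntermediateField.mem_bot.mp ((IsGalois.mem_bot_iff_fixed _).mpr hfix)
  have : (k : ℂ) = gaussSumStd θ / (gaussSumStd χ * gaussSumStd ψ) := by
    rw [← h₁, ← h₂, ← h₃]
    exact congrArg (Subtype.val) hk
  rw [← this]
  exact k.2
end
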